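/- (Convergence of the synchronous Distributed Dual Proximal Gradient) Let G = ({1,…,n}, E) be a fixed, undirected, connected graph with neighbor sets N_i. For each i, let f_i : ℝ^d → ℝ ∪ {+∞} be proper, closed and strongly convex with parameter σ_i > 0, and let g_i : ℝ^d → ℝ ∪ {+∞} be proper, closed and convex; assume the relative interiors of dom Σ_i f_i and dom Σ_i g_i intersect. Define the dual cost Γ(y) := Σ_i f_i*( −Σ_{j∈N_i}(λ_i^j − λ_j^i) − μ_i ) + Σ_i g_i*(μ_i) over y = (y_1,…,y_n), y_i = ((λ_i^j)_{j∈N_i}, μ_i). Choose step-sizes 0 < α_i ≤ 1/(n L_i) with L_i = sqrt( 1/σ_i² + Σ_{j∈N_i}(1/σ_i + 1/σ_j)² ). Consider the iteration: x_i⋆(t) = argmin_{x} { ⟨x, Σ_{j∈N_i}(λ_i^j(t) − λ_j^i(t)) + μ_i(t)⟩ + f_i(x) }; λ_i^j(t+1) = λ_i^j(t) + α_i ( x_i⋆(t) − x_j⋆(t) ) for all j ∈ N_i; μ̃_i = μ_i(t) + α_i x_i⋆(t); μ_i(t+1) = μ̃_i − α_i · prox_{(1/α_i) g_i}( μ̃_i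 / α_i ). Then the generated sequence y(t) satisfies, for every minimizer y⋆ of Γ and all t ≥ 1, Γ(y(t)) − Γ(y⋆) ≤ ‖y_0 − y⋆‖²_{D_α⁻¹} / (2t), where y_0 is the initial condition and D_α is the block-diagonal matrix with i-th block α_i I. -/

import Mathlib

open scoped RealInnerProductSpace BigOperators

noncomputable section

/-- The Legendre–Fenchel conjugate of an extended-real-valued function. -/
def conjugateFn {d : ℕ} (φ : EuclideanSpace ℝ (Fin d) → EReal) :
    EuclideanSpace ℝ (Fin d) → EReal :=
  fun y => ⨆ x : EuclideanSpace ℝ (Fin d), (⟪y, x⟫ : EReal) - φ x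

/-- `φ` is proper: it never takes the value `-∞` and is not identically `+∞`. -/
def ProperFn {d : ℕ} (φ : EuclideanSpace ℝ (Fin d) → EReal) : Prop :=
  (∀ x, φ x ≠ ⊥) ∧ ∃ x, φ x ≠ ⊤

/-- `φ` is convex (as an extended-real-valued function). -/
def ConvexFn {d : ℕ} (φ : EuclideanSpace ℝ (Fin d) → EReal) : Prop :=
  ∀ x y : EuclideanSpace ℝ (Fin d), ∀ a b : ℝ, 0 ≤ a → 0 ≤ b → a + b = 1 →
    φ (a • x + b • y) ≤ (a : EReal) * φ x + (b : EReal) * φ y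

/-- `φ` is strongly convex with parameter `σ`: `φ − (σ/2)‖·‖²` is convex. -/
def StronglyConvexFn {d : ℕ} (σ : ℝ) (φ : EuclideanSpace ℝ (Fin d) → EReal) : Prop :=
  ConvexFn (fun x => φ x - (((σ / 2) * ‖x‖ ^ 2 : ℝ) : EReal))

/-- The dual cost `Γ(y) = Σ_i f_i*(−Σ_{j∈N_i}(λ_i^j − λ_j^i) − μ_i) + Σ_i g_i*(μ_i)`,
as a function of the stacked dual variable `y = ((λ_i^j)_{i,j}, (μ_i)_i)`. -/
def dualCost {n d : ℕ} (G : SimpleGraph (Fin n)) [DecidableRel G.Adj]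
    (f g : Fin n → EuclideanSpace ℝ (Fin d) → EReal)
    (lam : Fin n → Fin n → EuclideanSpace ℝ (Fin d))
    (mu : Fin n → EuclideanSpace ℝ (Fin d)) : EReal :=
  (∑ i, conjugateFn (f i)
      (-(∑ j ∈ G.neighborFinset i, (lam i j - lam j i)) - mu i)) +
    ∑ i, conjugateFn (g i) (mu i)

section Abstract
variable {H : Type*} [NormedAddCommGroup H] [InnerProductSpace ℝ H]

theorem proxGrad_first_step (a b h k : H) {φ₀ φ₁ γ₁ Fu Gu : ℝ}
    (hF : 3 / 4 * (φ₀ - ⟪h, a⟫) + 1 / 4 * (φ₁ - ⟪h + k, b⟫) + 3 / 40 * ‖k‖ ^ 2 ≤ Fu)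
    (hC : φ₁ + ⟪h + k, a - b⟫ + 2 / 5 * ‖k‖ ^ 2 ≤ φ₀)
    (hG : γ₁ - ⟪a - b - h, b⟫ ≤ Gu) :
    4 / 3 * (φ₁ + γ₁ - Fu - Gu) + 4 / 9 * ‖b‖ ^ 2 ≤ 1 / 2 * ‖a‖ ^ 2 := by
  have h0 : 0 ≤ ‖(3 / 4 : ℝ) • k - (b - (3 / 4 : ℝ) • a)‖ ^ 2 := sq_nonneg _
  simp only [← real_inner_self_eq_norm_sq, inner_add_left, inner_sub_left, inner_sub_right,
    real_inner_smul_left, real_inner_smul_right] at *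
  have e1 := real_inner_comm a b
  have e2 := real_inner_comm k b
  have e3 := real_inner_comm k a
  have e4 := real_inner_comm h a
  have e5 := real_inner_comm h b
  linarith

theorem proxGrad_later_step (a b h k : H) {φ₀ φ₁ γ₀ γ₁ Fu Gu : ℝ} {A : ℝ} (hA : 0 ≤ A)
    (hF : φ₀ - ⟪h, a⟫ ≤ Fu)
    (hC : φ₁ + ⟪h + k, a - b⟫ + 2 / 5 * ‖k‖ ^ 2 ≤ φ₀)
    (hG : γ₁ - ⟪a - b - h, b⟫ ≤ Gu)
    (hG0 : γ₁ + ⟪a - b - h, a - b⟫ ≤ γ₀) :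
    (A + 8 / 9) * (φ₁ + γ₁ - Fu - Gu) + 4 / 9 * ‖b‖ ^ 2 + (3 / 8 * A - 1 / 9) * ‖a - b‖ ^ 2
      ≤ A * (φ₀ + γ₀ - Fu - Gu) + 4 / 9 * ‖a‖ ^ 2 := by
  have h0 : 0 ≤ ‖(4 / 5 : ℝ) • k + (a - b)‖ ^ 2 := sq_nonneg _
  have e1 := real_inner_comm a b
  have e2 := real_inner_comm k b
  have e3 := real_inner_comm k a
  have e4 := real_inner_comm h a
  have e5 := real_inner_comm h b
  have d1 : φ₁ + γ₁ + 3 / 8 * ‖a - b‖ ^ 2 ≤ φ₀ + γ₀ := by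
    simp only [← real_inner_self_eq_norm_sq, inner_add_left, inner_sub_left, inner_sub_right,
      inner_add_right, real_inner_smul_left, real_inner_smul_right] at *
    linarith
  have d2 : φ₁ + γ₁ - Fu - Gu ≤ 1 / 2 * (‖a‖ ^ 2 - ‖b‖ ^ 2) + 1 / 8 * ‖a - b‖ ^ 2 := by
    simp only [← real_inner_self_eq_norm_sq, inner_add_left, inner_sub_left, inner_sub_right,
      inner_add_right, real_inner_smul_left, real_inner_smul_right] at *
    linarith
  linarith [mul_le_mul_of_nonneg_left d1 hA]

/-- A gradient step of a `5/4`-cocoercive map is nonexpansive. -/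
theorem norm_add_le_of_cocoercive {D k : H} (h : ‖k‖ ^ 2 ≤ 5 / 4 * -⟪k, D⟫) :
    ‖D + k‖ ≤ ‖D‖ := by
  refine abs_le_of_sq_le_sq' ?_ (norm_nonneg _) |>.2
  rw [norm_add_sq_real, real_inner_comm]
  nlinarith [sq_nonneg ‖k‖]

/-- The proximal gradient method with unit step, for a smooth part whose gradient is
`5/4`-Lipschitz: the classical `1/(2t)` rate still holds although the step exceeds `1/L`. -/
theorem proxGrad_rate (z h : ℕ → H) (φ γ : ℕ → ℝ) (u : H) (Fu Gu : ℝ)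
    (hF : ∀ s t (p : ℝ), 0 ≤ p → p ≤ 1 →
      p * (φ s + ⟪h s, u - z s⟫) + (1 - p) * (φ t + ⟪h t, u - z t⟫)
        + p * (1 - p) * (2 / 5 * ‖h s - h t‖ ^ 2) ≤ Fu)
    (hC : ∀ s t, φ s + ⟪h s, z t - z s⟫ + 2 / 5 * ‖h s - h t‖ ^ 2 ≤ φ t)
    (hGu : ∀ t, γ (t + 1) + ⟪z t - z (t + 1) - h t, u - z (t + 1)⟫ ≤ Gu)
    (hG : ∀ t s, γ (t + 1) + ⟪z t - z (t + 1) - h t, z (s + 1) - z (t + 1)⟫ ≤ γ (s + 1))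
    (t : ℕ) :
    ((t : ℝ) + 1) * (φ (t + 1) + γ (t + 1) - Fu - Gu) ≤ 1 / 2 * ‖z 0 - u‖ ^ 2 := by
  have coco (t) : ‖h (t + 1) - h t‖ ^ 2 ≤ 5 / 4 * -⟪h (t + 1) - h t, z t - z (t + 1)⟫ := by
    have h1 := hC t (t + 1)
    have h2 := hC (t + 1) t
    rw [norm_sub_rev] at h1
    rw [← neg_sub (z t) (z (t + 1)), inner_neg_right] at h1
    rw [inner_sub_left]
    linarith
  have step (t) : ‖z t - z (t + 1) + (h (t + 1) - h t)‖ ≤ ‖z t - z (t + 1)‖ :=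
    norm_add_le_of_cocoercive (coco t)
  have mono (t) : ‖z (t + 1) - z (t + 2)‖ ≤ ‖z t - z (t + 1)‖ := by
    refine le_trans ?_ (step t)
    have h1 := hG t (t + 1)
    have h2 := hG (t + 1) t
    have h3 := real_inner_le_norm (z t - z (t + 1) + (h (t + 1) - h t)) (z (t + 1) - z (t + 2))
    have h4 : ‖z (t + 1) - z (t + 2)‖ ^ 2
        ≤ ⟪z t - z (t + 1) + (h (t + 1) - h t), z (t + 1) - z (t + 2)⟫ := by
      rw [← real_inner_self_eq_norm_sq]
      simp only [inner_add_left, inner_sub_left, inner_sub_right, show t + 1 + 1 = t + 2 from rfl]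
        at h1 h2 ⊢
      linarith
    rcases (norm_nonneg (z (t + 1) - z (t + 2))).eq_or_lt with h5 | h5
    · rw [← h5]; exact norm_nonneg _
    · exact le_of_mul_le_mul_right (by nlinarith) h5
  have eqC (t) : φ (t + 1) + ⟪h t + (h (t + 1) - h t), (z t - u) - (z (t + 1) - u)⟫
      + 2 / 5 * ‖h (t + 1) - h t‖ ^ 2 ≤ φ t := by
    rw [add_sub_cancel, sub_sub_sub_cancel_right]
    exact hC (t + 1) t
  have eqG (t) : γ (t + 1) - ⟪(z t - u) - (z (t + 1) - u) - h t, z (t + 1) - u⟫ ≤ Gu := by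
    rw [sub_sub_sub_cancel_right, sub_eq_add_neg, ← inner_neg_right, neg_sub]
    exact hGu t
  have main (t : ℕ) : (8 * (t : ℝ) + 12) / 9 * (φ (t + 1) + γ (t + 1) - Fu - Gu)
      + 4 / 9 * ‖z (t + 1) - u‖ ^ 2 + (t : ℝ) * (t + 1) / 6 * ‖z t - z (t + 1)‖ ^ 2
      ≤ 1 / 2 * ‖z 0 - u‖ ^ 2 := by
    induction t with
    | zero =>
      have h1 := hF 0 1 (3 / 4) (by norm_num) (by norm_num)
      rw [← neg_sub (z 0) u, ← neg_sub (z 1) u, inner_neg_right, inner_neg_right,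
        norm_sub_rev] at h1
      have := proxGrad_first_step (z 0 - u) (z 1 - u) (h 0) (h 1 - h 0) (φ₀ := φ 0) (φ₁ := φ 1)
        (γ₁ := γ 1) (Fu := Fu) (Gu := Gu) (by rw [add_sub_cancel]; linarith) (eqC 0) (eqG 0)
      norm_num
      linarith
    | succ t ih =>
      have h1 := hF (t + 1) (t + 1) 1 (by norm_num) (by norm_num)
      rw [← neg_sub (z (t + 1)) u, inner_neg_right] at h1
      have h2 := proxGrad_later_step (z (t + 1) - u) (z (t + 2) - u) (h (t + 1))
        (h (t + 2) - h (t + 1)) (φ₀ := φ (t + 1)) (φ₁ := φ (t + 2)) (γ₀ := γ (t + 1))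
        (γ₁ := γ (t + 2)) (Fu := Fu) (Gu := Gu) (A := (8 * (t : ℝ) + 12) / 9) (by positivity)
        (by linarith) (eqC (t + 1)) (eqG (t + 1))
        (by rw [sub_sub_sub_cancel_right]; exact hG (t + 1) t)
      rw [sub_sub_sub_cancel_right] at h2
      have h3 : ‖z (t + 1) - z (t + 2)‖ ^ 2 ≤ ‖z t - z (t + 1)‖ ^ 2 := by
        gcongr; exact mono t
      have h4 := mul_le_mul_of_nonneg_left h3 (show 0 ≤ (t : ℝ) * (t + 1) / 6 by positivity)
      have h5 := sq_nonneg ‖z (t + 1) - z (t + 2)‖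
      push_cast
      simp only [show t + 1 + 1 = t + 2 from rfl]
      linarith
  have hδ : φ (t + 1) + γ (t + 1) - Fu - Gu ≤ ‖z t - z (t + 1)‖ * ‖z (t + 1) - u‖ := by
    have h1 := hF (t + 1) (t + 1) 1 (by norm_num) (by norm_num)
    have h2 := hGu t
    have h3 := real_inner_le_norm (z t - z (t + 1) + (h (t + 1) - h t)) (z (t + 1) - u)
    have h4 := mul_le_mul_of_nonneg_right (step t) (norm_nonneg (z (t + 1) - u))
    rw [← neg_sub (z (t + 1)) u, inner_neg_right] at h1 h2
    simp only [inner_add_left, inner_sub_left] at h2 h3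
    linarith
  have hm := main t
  set δ := φ (t + 1) + γ (t + 1) - Fu - Gu
  set D := ‖z t - z (t + 1)‖
  set b := ‖z (t + 1) - u‖
  have hT : (0 : ℝ) ≤ t := t.cast_nonneg
  rcases le_total δ 0 with h0 | h0
  · nlinarith [mul_nonneg hT (neg_nonneg.2 h0), sq_nonneg ‖z 0 - u‖]
  · have h1 := mul_le_mul_of_nonneg_left hδ hT
    nlinarith [sq_nonneg (b - (t : ℝ) * D / 4), mul_nonneg hT (sq_nonneg D),
      sq_nonneg ((t : ℝ) * D), sq_nonneg b]

end Abstract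

section ConvexAnalysis
variable {d : ℕ} {φ : EuclideanSpace ℝ (Fin d) → EReal}

/-- Real-valued form of strong convexity, in terms of upper bounds for the function values. -/
def EpiStronglyConvex {d : ℕ} (σ : ℝ) (φ : EuclideanSpace ℝ (Fin d) → EReal) : Prop :=
  ∀ x y : EuclideanSpace ℝ (Fin d), ∀ r s a b : ℝ, 0 ≤ a → 0 ≤ b → a + b = 1 →
    φ x ≤ r → φ y ≤ s →
    φ (a • x + b • y) ≤ ((a * r + b * s - σ / 2 * (a * b * ‖x - y‖ ^ 2) : ℝ) : EReal)

theorem norm_sq_convex_combination {E : Type*} [NormedAddCommGroup E] [InnerProductSpace ℝ E]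
    (x y : E) {a b : ℝ} (hab : a + b = 1) :
    ‖a • x + b • y‖ ^ 2 = a * ‖x‖ ^ 2 + b * ‖y‖ ^ 2 - a * b * ‖x - y‖ ^ 2 := by
  obtain rfl : b = 1 - a := by linarith
  simp only [← real_inner_self_eq_norm_sq, inner_add_left, inner_sub_left, inner_sub_right,
    inner_add_right, real_inner_smul_left, real_inner_smul_right, real_inner_comm x y]
  ring

theorem EReal.convex_combination_le {a b r s : ℝ} {u v : EReal} (ha : 0 ≤ a) (hb : 0 ≤ b)
    (hu : u ≤ r) (hv : v ≤ s) : (a : EReal) * u + (b : EReal) * v ≤ ((a * r + b * s : ℝ)) := by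
  rw [EReal.coe_add, EReal.coe_mul, EReal.coe_mul]
  exact add_le_add (mul_le_mul_of_nonneg_left hu (EReal.coe_nonneg.2 ha))
    (mul_le_mul_of_nonneg_left hv (EReal.coe_nonneg.2 hb))

theorem EReal.sub_coe_le_coe_iff {u : EReal} {q r : ℝ} :
    u - (q : EReal) ≤ (r : EReal) ↔ u ≤ ((r + q : ℝ) : EReal) := by
  rw [EReal.coe_add]
  exact EReal.sub_le_iff_le_add (.inl (EReal.coe_ne_bot _)) (.inl (EReal.coe_ne_top _))

theorem StronglyConvexFn.epi {σ : ℝ} (h : StronglyConvexFn σ φ) : EpiStronglyConvex σ φ := by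
  intro x y r s a b ha hb hab hx hy
  have h1 := (h x y a b ha hb hab).trans (EReal.convex_combination_le ha hb
    (r := r - σ / 2 * ‖x‖ ^ 2) (s := s - σ / 2 * ‖y‖ ^ 2)
    (EReal.sub_coe_le_coe_iff.2 (by simpa using hx))
    (EReal.sub_coe_le_coe_iff.2 (by simpa using hy)))
  refine (EReal.sub_coe_le_coe_iff.1 h1).trans (EReal.coe_le_coe_iff.2 (le_of_eq ?_))
  rw [norm_sq_convex_combination x y hab]
  ring

theorem ConvexFn.epi (h : ConvexFn φ) : EpiStronglyConvex 0 φ := by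
  intro x y r s a b ha hb hab hx hy
  refine (h x y a b ha hb hab).trans ((EReal.convex_combination_le ha hb hx hy).trans ?_)
  simp

/-- Quadratic growth around a minimizer of a strongly convex sum. -/
theorem EpiStronglyConvex.growth {σ τ : ℝ} (hφ : EpiStronglyConvex σ φ)
    {q : EuclideanSpace ℝ (Fin d) → ℝ}
    (hq : ∀ x y, ∀ a b : ℝ, a + b = 1 →
      q (a • x + b • y) = a * q x + b * q y - τ / 2 * (a * b * ‖x - y‖ ^ 2))
    {p : EuclideanSpace ℝ (Fin d)} {m : ℝ} (hp : φ p ≤ m)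
    (hmin : ∀ x (r : ℝ), φ x ≤ r → m + q p ≤ r + q x)
    {x : EuclideanSpace ℝ (Fin d)} {r : ℝ} (hx : φ x ≤ r) :
    m + q p + (σ + τ) / 2 * ‖x - p‖ ^ 2 ≤ r + q x := by
  set c := (σ + τ) / 2 * ‖x - p‖ ^ 2 with hc
  have key (a : ℝ) (h0 : 0 < a) (h1 : a ≤ 1) : (1 - a) * c ≤ r + q x - (m + q p) := by
    have h2 := hmin _ _ (hφ x p r m a (1 - a) h0.le (by linarith) (by ring) hx hp)
    rw [hq x p a (1 - a) (by ring)] at h2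
    refine le_of_mul_le_mul_left ?_ h0
    rw [hc]
    linarith
  by_contra! hlt
  have h0 := key 1 one_pos le_rfl
  have hcpos : 0 < c := by linarith
  have h1 := key ((c - (r + q x - (m + q p))) / (2 * c))
    (div_pos (by linarith) (by linarith)) ((div_le_one (by linarith)).2 (by linarith))
  have h2 : (1 - (c - (r + q x - (m + q p))) / (2 * c)) * c
      = (c + (r + q x - (m + q p))) / 2 := by field_simp; ring
  linarith

theorem ProperFn.exists_coe_of_minimizer (hφ : ProperFn φ)
    {q : EuclideanSpace ℝ (Fin d) → ℝ} {p : EuclideanSpace ℝ (Fin d)}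
    (hmin : ∀ x, (q p : EReal) + φ p ≤ (q x : EReal) + φ x) :
    ∃ m : ℝ, φ p = m ∧ ∀ x (r : ℝ), φ x ≤ r → m + q p ≤ r + q x := by
  have hfin (x) (r : ℝ) (h : φ x ≤ r) : (q p : EReal) + φ p ≤ ((q x + r : ℝ) : EReal) :=
    (hmin x).trans (by rw [EReal.coe_add]; exact add_le_add_right h _)
  obtain ⟨x₀, hx₀⟩ := hφ.2
  have htop : φ p ≠ ⊤ := by
    intro h
    have := hfin x₀ (φ x₀).toReal (EReal.le_coe_toReal hx₀)
    rw [h, EReal.coe_add_top] at this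
    exact EReal.coe_ne_top _ (top_le_iff.1 this)
  refine ⟨(φ p).toReal, (EReal.coe_toReal htop (hφ.1 p)).symm, fun x r h => ?_⟩
  have h1 := hfin x r h
  rw [← EReal.coe_toReal htop (hφ.1 p), ← EReal.coe_add, EReal.coe_le_coe_iff] at h1
  linarith

theorem le_conjugateFn (y : EuclideanSpace ℝ (Fin d)) {x : EuclideanSpace ℝ (Fin d)} {r : ℝ}
    (h : φ x ≤ r) : ((⟪y, x⟫ - r : ℝ) : EReal) ≤ conjugateFn φ y := by
  refine le_trans ?_ (le_iSup _ x)
  rw [EReal.coe_sub]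
  exact EReal.sub_le_sub le_rfl h

theorem conjugateFn_eq (hφ : ProperFn φ) {y x₀ : EuclideanSpace ℝ (Fin d)} {m : ℝ}
    (hm : φ x₀ = m) (h : ∀ x (r : ℝ), φ x ≤ r → ⟪y, x⟫ - r ≤ ⟪y, x₀⟫ - m) :
    conjugateFn φ y = ((⟪y, x₀⟫ - m : ℝ) : EReal) := by
  refine le_antisymm (iSup_le fun x => ?_) (le_conjugateFn y hm.le)
  by_cases hx : φ x = ⊤
  · rw [hx, EReal.sub_top]; exact bot_le
  · have := h x (φ x).toReal (EReal.le_coe_toReal hx)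
    rw [← EReal.coe_toReal hx (hφ.1 x), ← EReal.coe_sub]
    exact EReal.coe_le_coe_iff.2 this

theorem conjugateFn_ne_bot (hφ : ProperFn φ) (y : EuclideanSpace ℝ (Fin d)) :
    conjugateFn φ y ≠ ⊥ := by
  obtain ⟨x, hx⟩ := hφ.2
  exact ne_bot_of_le_ne_bot (EReal.coe_ne_bot _) (le_conjugateFn y (EReal.le_coe_toReal hx))

theorem EReal.sum_ne_bot {ι : Type*} {s : Finset ι} {F : ι → EReal} (h : ∀ i ∈ s, F i ≠ ⊥) :
    ∑ i ∈ s, F i ≠ ⊥ := by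
  classical
  induction s using Finset.induction_on with
  | empty => simp
  | insert i s hi ih =>
    rw [Finset.sum_insert hi, Ne, EReal.add_eq_bot_iff, not_or]
    exact ⟨h i (Finset.mem_insert_self _ _), ih fun j hj => h j (Finset.mem_insert_of_mem hj)⟩

theorem EReal.ne_top_of_sum_ne_top {ι : Type*} {s : Finset ι} {F : ι → EReal}
    (h : ∀ i ∈ s, F i ≠ ⊥) (hs : ∑ i ∈ s, F i ≠ ⊤) {i : ι} (hi : i ∈ s) : F i ≠ ⊤ := by
  classical
  intro ht
  rw [← Finset.add_sum_erase s F hi, ht, EReal.top_add_of_ne_bot] at hs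
  · exact hs rfl
  · exact EReal.sum_ne_bot fun j hj => h j (Finset.mem_of_mem_erase hj)

theorem EReal.coe_sum {ι : Type*} (s : Finset ι) (F : ι → ℝ) :
    ((∑ i ∈ s, F i : ℝ) : EReal) = ∑ i ∈ s, (F i : EReal) :=
  map_sum (⟨⟨Real.toEReal, EReal.coe_zero⟩, EReal.coe_add⟩ : ℝ →+ EReal) F s

end ConvexAnalysis

section StepSizes

/-- The step-size rule bounds the weighted operator norm of the dual constraint map. -/
theorem stepSize_coupling_le {n : ℕ} (G : SimpleGraph (Fin n)) [DecidableRel G.Adj]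
    {σ α : Fin n → ℝ} (hσ : ∀ i, 0 < σ i) (hαpos : ∀ i, 0 < α i)
    (hαle : ∀ i, α i ≤ 1 / (n * Real.sqrt ((1 / σ i) ^ 2 +
      ∑ j ∈ G.neighborFinset i, (1 / σ i + 1 / σ j) ^ 2))) (i : Fin n) :
    α i * (1 / σ i) + ∑ j ∈ G.neighborFinset i, (α i + α j) * (1 / σ i + 1 / σ j) ≤ 5 / 4 := by
  have hn : 0 < (n : ℝ) := Nat.cast_pos.2 i.pos
  have hq (i) : 0 < 1 / σ i := one_div_pos.2 (hσ i)
  have hsq (i) : 0 < (1 / σ i) ^ 2 + ∑ j ∈ G.neighborFinset i, (1 / σ i + 1 / σ j) ^ 2 :=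
    add_pos_of_pos_of_nonneg (pow_pos (hq i) 2) (Finset.sum_nonneg fun _ _ => sq_nonneg _)
  have hbound (i) {B m : ℝ} (hm : 0 ≤ m) (hB : B ^ 2 ≤ m * ((1 / σ i) ^ 2 +
      ∑ j ∈ G.neighborFinset i, (1 / σ i + 1 / σ j) ^ 2)) : n * (α i * B) ≤ √m := by
    have h1 : B ≤ √m * √((1 / σ i) ^ 2 + ∑ j ∈ G.neighborFinset i, (1 / σ i + 1 / σ j) ^ 2) := by
      rw [← Real.sqrt_mul hm]
      exact Real.le_sqrt_of_sq_le hB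
    have h2 := hαle i
    rw [le_div_iff₀ (mul_pos hn (Real.sqrt_pos.2 (hsq i)))] at h2
    have h3 := mul_le_mul_of_nonneg_left h1 (mul_nonneg hn.le (hαpos i).le)
    have h4 := mul_le_mul_of_nonneg_left h2 (Real.sqrt_nonneg m)
    linarith
  have hnb : ∀ j ∈ G.neighborFinset i, n * (α j * (1 / σ i + 1 / σ j)) ≤ 1 := by
    intro j hj
    have hji : i ∈ G.neighborFinset j := by
      rw [SimpleGraph.mem_neighborFinset] at hj ⊢
      exact hj.symm
    refine (hbound j zero_le_one ?_).trans_eq Real.sqrt_one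
    rw [one_mul, add_comm (1 / σ i)]
    exact (Finset.single_le_sum (f := fun k => (1 / σ j + 1 / σ k) ^ 2)
      (fun _ _ => sq_nonneg _) hji).trans (le_add_of_nonneg_left (sq_nonneg _))
  set m := (G.neighborFinset i).card with hm
  have hmn : (m : ℝ) + 1 ≤ n := by
    have : m < n := by simpa [hm] using G.degree_lt_card_verts i
    exact_mod_cast this
  have hown : n * (α i * (1 / σ i + ∑ j ∈ G.neighborFinset i, (1 / σ i + 1 / σ j)))
      ≤ √((m : ℝ) + 1) := by
    refine hbound i (by positivity) ?_
    have h1 := sq_sum_le_card_mul_sum_sq (s := G.neighborFinset i) (f := fun j => 1 / σ i + 1 / σ j)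
    rw [← hm] at h1
    set S := ∑ j ∈ G.neighborFinset i, (1 / σ i + 1 / σ j)
    set T := ∑ j ∈ G.neighborFinset i, (1 / σ i + 1 / σ j) ^ 2
    rcases Nat.eq_zero_or_pos m with h0 | h0
    · have hS : S = 0 := by
        rw [h0] at h1
        exact pow_eq_zero_iff two_ne_zero |>.1 (le_antisymm (by simpa using h1) (sq_nonneg _))
      have hT : 0 ≤ T := Finset.sum_nonneg fun _ _ => sq_nonneg _
      rw [hS, h0]
      simpa using hT
    · have h2 : (0 : ℝ) < m := Nat.cast_pos.2 h0
      have h3 : 2 * (1 / σ i) * S ≤ m * (1 / σ i) ^ 2 + T := by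
        refine le_of_mul_le_mul_left ?_ h2
        nlinarith [sq_nonneg (m * (1 / σ i) - S)]
      nlinarith
  have hsum : n * ∑ j ∈ G.neighborFinset i, α j * (1 / σ i + 1 / σ j) ≤ m := by
    rw [Finset.mul_sum]
    simpa [hm] using Finset.sum_le_sum hnb
  have hsqrt : √((m : ℝ) + 1) ≤ (m + 1) / 4 + 1 := by
    rw [Real.sqrt_le_left (by positivity)]
    nlinarith [sq_nonneg (((m : ℝ) + 1) / 4 - 1)]
  refine le_of_mul_le_mul_left ?_ hn
  simp only [add_mul (α i), Finset.sum_add_distrib]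
  rw [← Finset.mul_sum]
  linarith

end StepSizes

section DualSpace
variable {n d : ℕ} (G : SimpleGraph (Fin n)) [DecidableRel G.Adj]

/-- The space of stacked dual variables. -/
abbrev DualSpace (n d : ℕ) : Type :=
  PiLp 2 fun _ : Fin n × Option (Fin n) => EuclideanSpace ℝ (Fin d)

/-- The dual variables scaled by `1 / √α_i`, so that the Euclidean norm is the weighted one. -/
def scaledDual (α : Fin n → ℝ) (lam : Fin n → Fin n → EuclideanSpace ℝ (Fin d))
    (mu : Fin n → EuclideanSpace ℝ (Fin d)) : DualSpace n d :=
  WithLp.toLp 2 fun io => match io.2 with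
    | none => (√(α io.1))⁻¹ • mu io.1
    | some j => if G.Adj io.1 j then (√(α io.1))⁻¹ • lam io.1 j else 0

/-- The gradient of the smooth part of the dual cost in scaled coordinates. -/
def scaledGrad (α : Fin n → ℝ) (x : Fin n → EuclideanSpace ℝ (Fin d)) : DualSpace n d :=
  WithLp.toLp 2 fun io => match io.2 with
    | none => -√(α io.1) • x io.1
    | some j => if G.Adj io.1 j then -√(α io.1) • (x io.1 - x j) else 0

/-- The argument of the conjugates of the `f_i`, up to sign. -/
def dualArg (lam : Fin n → Fin n → EuclideanSpace ℝ (Fin d))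
    (mu : Fin n → EuclideanSpace ℝ (Fin d)) (i : Fin n) : EuclideanSpace ℝ (Fin d) :=
  (∑ j ∈ G.neighborFinset i, (lam i j - lam j i)) + mu i

theorem sum_ite_adj (i : Fin n) (F : Fin n → ℝ) :
    ∑ j, (if G.Adj i j then F j else 0) = ∑ j ∈ G.neighborFinset i, F j := by
  rw [← Finset.sum_filter]
  congr 1
  ext j
  simp

theorem sum_neighbor_comm (F : Fin n → Fin n → ℝ) :
    ∑ i, ∑ j ∈ G.neighborFinset i, F i j = ∑ i, ∑ j ∈ G.neighborFinset i, F j i := by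
  simp only [← sum_ite_adj]
  rw [Finset.sum_comm]
  simp only [G.adj_comm]

variable {α : Fin n → ℝ}

theorem inner_scaledGrad (hα : ∀ i, 0 < α i) (x : Fin n → EuclideanSpace ℝ (Fin d))
    (lam : Fin n → Fin n → EuclideanSpace ℝ (Fin d)) (mu : Fin n → EuclideanSpace ℝ (Fin d)) :
    ⟪scaledGrad G α x, scaledDual G α lam mu⟫ = -∑ i, ⟪x i, dualArg G lam mu i⟫ := by
  have hs (i) : (√(α i))⁻¹ * √(α i) = 1 := inv_mul_cancel₀ (Real.sqrt_pos.2 (hα i)).ne'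
  have h1 (i) : ⟪(scaledGrad G α x) (i, none), (scaledDual G α lam mu) (i, none)⟫
      = -⟪x i, mu i⟫ := by
    simp [scaledGrad, scaledDual, real_inner_smul_left, real_inner_smul_right, ← mul_assoc, hs]
  have h2 (i j) : ⟪(scaledGrad G α x) (i, some j), (scaledDual G α lam mu) (i, some j)⟫
      = if G.Adj i j then -⟪x i - x j, lam i j⟫ else 0 := by
    by_cases h : G.Adj i j
    · simp [scaledGrad, scaledDual, h, real_inner_smul_left, real_inner_smul_right, ← mul_assoc, hs]
    · simp [scaledGrad, h]
  rw [PiLp.inner_apply, Fintype.sum_prod_type]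
  simp only [Fintype.sum_option, h1, h2, sum_ite_adj, dualArg, inner_add_right, inner_sum,
    inner_sub_left, inner_sub_right, Finset.sum_add_distrib, Finset.sum_neg_distrib,
    Finset.sum_sub_distrib]
  rw [sum_neighbor_comm G fun i j => ⟪x i, lam j i⟫]
  ring

theorem norm_sq_scaledGrad (hα : ∀ i, 0 < α i) (x : Fin n → EuclideanSpace ℝ (Fin d)) :
    ‖scaledGrad G α x‖ ^ 2
      = ∑ i, (α i * ‖x i‖ ^ 2 + ∑ j ∈ G.neighborFinset i, α i * ‖x i - x j‖ ^ 2) := by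
  have h1 (i) : ‖(scaledGrad G α x) (i, none)‖ ^ 2 = α i * ‖x i‖ ^ 2 := by
    simp [scaledGrad, norm_smul, mul_pow, Real.sq_sqrt (hα i).le]
  have h2 (i j) : ‖(scaledGrad G α x) (i, some j)‖ ^ 2
      = if G.Adj i j then α i * ‖x i - x j‖ ^ 2 else 0 := by
    by_cases h : G.Adj i j
    · simp [scaledGrad, h, norm_smul, mul_pow, Real.sq_sqrt (hα i).le]
    · simp [scaledGrad, h]
  rw [PiLp.norm_sq_eq_of_L2, Fintype.sum_prod_type]
  simp only [Fintype.sum_option, h1, h2, sum_ite_adj]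

theorem norm_sq_scaledDual (hα : ∀ i, 0 < α i)
    (lam : Fin n → Fin n → EuclideanSpace ℝ (Fin d)) (mu : Fin n → EuclideanSpace ℝ (Fin d)) :
    ‖scaledDual G α lam mu‖ ^ 2
      = ∑ i, (1 / α i) * ((∑ j ∈ G.neighborFinset i, ‖lam i j‖ ^ 2) + ‖mu i‖ ^ 2) := by
  have h1 (i) : ‖(scaledDual G α lam mu) (i, none)‖ ^ 2 = 1 / α i * ‖mu i‖ ^ 2 := by
    simp [scaledDual, norm_smul, mul_pow, Real.sq_sqrt (hα i).le]
  have h2 (i j) : ‖(scaledDual G α lam mu) (i, some j)‖ ^ 2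
      = if G.Adj i j then 1 / α i * ‖lam i j‖ ^ 2 else 0 := by
    by_cases h : G.Adj i j
    · simp [scaledDual, h, norm_smul, mul_pow, Real.sq_sqrt (hα i).le]
    · simp [scaledDual, h]
  rw [PiLp.norm_sq_eq_of_L2, Fintype.sum_prod_type]
  simp only [Fintype.sum_option, h1, h2, sum_ite_adj, mul_add, Finset.mul_sum, add_comm]

theorem scaledDual_sub (lam lam' : Fin n → Fin n → EuclideanSpace ℝ (Fin d))
    (mu mu' : Fin n → EuclideanSpace ℝ (Fin d)) :
    scaledDual G α lam mu - scaledDual G α lam' mu'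
      = scaledDual G α (fun i j => lam i j - lam' i j) (fun i => mu i - mu' i) := by
  ext ⟨i, _ | j⟩ : 1
  · simp [scaledDual, smul_sub]
  · by_cases h : G.Adj i j <;> simp [scaledDual, h, smul_sub]

theorem scaledGrad_sub (x x' : Fin n → EuclideanSpace ℝ (Fin d)) :
    scaledGrad G α x - scaledGrad G α x' = scaledGrad G α fun i => x i - x' i := by
  ext ⟨i, _ | j⟩ : 1
  · simp [scaledGrad, smul_sub]
  · by_cases h : G.Adj i j
    · simp [scaledGrad, h, smul_sub]; abel
    · simp [scaledGrad, h]

end DualSpace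

section Iteration
variable {n d : ℕ} (G : SimpleGraph (Fin n)) [DecidableRel G.Adj]

theorem dualArg_sub (lam lam' : Fin n → Fin n → EuclideanSpace ℝ (Fin d))
    (mu mu' : Fin n → EuclideanSpace ℝ (Fin d)) (i : Fin n) :
    dualArg G (fun i j => lam i j - lam' i j) (fun i => mu i - mu' i) i
      = dualArg G lam mu i - dualArg G lam' mu' i := by
  simp only [dualArg, Finset.sum_sub_distrib]
  abel

theorem dualCost_eq (f g : Fin n → EuclideanSpace ℝ (Fin d) → EReal)
    (lam : Fin n → Fin n → EuclideanSpace ℝ (Fin d)) (mu : Fin n → EuclideanSpace ℝ (Fin d)) :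
    dualCost G f g lam mu
      = (∑ i, conjugateFn (f i) (-dualArg G lam mu i)) + ∑ i, conjugateFn (g i) (mu i) := by
  simp only [dualCost, dualArg, neg_add']

theorem norm_sq_scaledGrad_le {σ α : Fin n → ℝ} (hσ : ∀ i, 0 < σ i) (hα : ∀ i, 0 < α i)
    (hαle : ∀ i, α i ≤ 1 / (n * Real.sqrt ((1 / σ i) ^ 2 +
      ∑ j ∈ G.neighborFinset i, (1 / σ i + 1 / σ j) ^ 2)))
    (x : Fin n → EuclideanSpace ℝ (Fin d)) :
    ‖scaledGrad G α x‖ ^ 2 ≤ 5 / 4 * ∑ i, σ i * ‖x i‖ ^ 2 := by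
  have hpair (i j) : ‖x i - x j‖ ^ 2
      ≤ (1 / σ i + 1 / σ j) * (σ i * ‖x i‖ ^ 2 + σ j * ‖x j‖ ^ 2) := by
    have h1 : ‖x i - x j‖ ^ 2 ≤ (‖x i‖ + ‖x j‖) ^ 2 := by
      gcongr
      exact norm_sub_le _ _
    refine h1.trans ?_
    have hi := hσ i
    have hj := hσ j
    have h2 : (1 / σ i + 1 / σ j) * (σ i * ‖x i‖ ^ 2 + σ j * ‖x j‖ ^ 2) - (‖x i‖ + ‖x j‖) ^ 2
        = (σ i * ‖x i‖ - σ j * ‖x j‖) ^ 2 / (σ i * σ j) := by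
      field_simp
      ring
    have h3 : 0 ≤ (σ i * ‖x i‖ - σ j * ‖x j‖) ^ 2 / (σ i * σ j) := by positivity
    linarith
  rw [norm_sq_scaledGrad G hα, Finset.mul_sum]
  calc _ ≤ ∑ i, (α i * ‖x i‖ ^ 2 + ∑ j ∈ G.neighborFinset i,
        (α i * (1 / σ i + 1 / σ j) * (σ i * ‖x i‖ ^ 2)
          + α i * (1 / σ i + 1 / σ j) * (σ j * ‖x j‖ ^ 2))) := by
        gcongr with i _ j _
        have := mul_le_mul_of_nonneg_left (hpair i j) (hα i).le
        linarith
    _ = ∑ i, (α i * (1 / σ i) + ∑ j ∈ G.neighborFinset i, (α i + α j) * (1 / σ i + 1 / σ j))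
          * (σ i * ‖x i‖ ^ 2) := by
        simp only [Finset.sum_add_distrib, add_mul (α _ * _), Finset.sum_mul]
        rw [sum_neighbor_comm G fun i j => α i * (1 / σ i + 1 / σ j) * (σ j * ‖x j‖ ^ 2)]
        simp only [← Finset.sum_add_distrib]
        refine Finset.sum_congr rfl fun i _ => ?_
        congr 1
        · have := (hσ i).ne'
          field_simp
        · refine Finset.sum_congr rfl fun j _ => ?_
          ring
    _ ≤ _ := by
        gcongr with i
        · exact mul_nonneg (hσ i).le (sq_nonneg _)
        · exact stepSize_coupling_le G hσ hα hαle i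

theorem scaledDual_step {α : Fin n → ℝ} (hα : ∀ i, 0 < α i)
    {lam lam' : Fin n → Fin n → EuclideanSpace ℝ (Fin d)}
    {mu mu' x p : Fin n → EuclideanSpace ℝ (Fin d)}
    (hlam : ∀ i j, G.Adj i j → lam' i j = lam i j + α i • (x i - x j))
    (hmu : ∀ i, mu' i = (mu i + α i • x i) - α i • p i)
    (l : Fin n → Fin n → EuclideanSpace ℝ (Fin d)) (m : Fin n → EuclideanSpace ℝ (Fin d)) :
    ⟪scaledDual G α lam mu - scaledDual G α lam' mu' - scaledGrad G α x, scaledDual G α l m⟫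
      = ∑ i, ⟪p i, m i⟫ := by
  have hs (i) : (√(α i))⁻¹ * √(α i) = 1 := inv_mul_cancel₀ (Real.sqrt_pos.2 (hα i)).ne'
  have hs' (i) : (√(α i))⁻¹ * α i = √(α i) := by
    rw [inv_mul_eq_div, Real.div_sqrt]
  have h1 (i) : (scaledDual G α lam mu - scaledDual G α lam' mu' - scaledGrad G α x) (i, none)
      = √(α i) • p i := by
    simp only [scaledDual, scaledGrad, hmu, smul_sub, smul_add, smul_smul, hs', PiLp.sub_apply]
    module
  have h2 (i j) :
      (scaledDual G α lam mu - scaledDual G α lam' mu' - scaledGrad G α x) (i, some j) = 0 := by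
    by_cases h : G.Adj i j
    · simp only [scaledDual, scaledGrad, h, hlam i j h, smul_sub, smul_add, smul_smul, hs',
        PiLp.sub_apply, if_true]
      module
    · simp [scaledDual, scaledGrad, h]
  rw [PiLp.inner_apply, Fintype.sum_prod_type]
  simp only [Fintype.sum_option, h1, h2]
  simp [scaledDual, real_inner_smul_left, real_inner_smul_right, ← mul_assoc, hs]

end Iteration

/-- **Convergence of the synchronous Distributed Dual Proximal Gradient.**
Over a fixed, undirected, connected graph, with `f_i` proper, closed, `σ_i`-strongly
convex, `g_i` proper, closed, convex, a constraint qualification, and local step-sizes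
`0 < α_i ≤ 1/(n L_i)` with `L_i = sqrt(1/σ_i² + Σ_{j∈N_i}(1/σ_i + 1/σ_j)²)`, the iterates
of the synchronous distributed dual proximal gradient algorithm satisfy, for every
minimizer `y⋆` of the dual cost `Γ` and all `t ≥ 1`,
`Γ(y(t)) − Γ(y⋆) ≤ ‖y_0 − y⋆‖²_{D_α⁻¹}/(2t)`. -/
theorem synchronous_DDPG_rate {n d : ℕ}
    (G : SimpleGraph (Fin n)) [DecidableRel G.Adj] (hconn : G.Connected)
    (σ : Fin n → ℝ) (hσ : ∀ i, 0 < σ i)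
    (f g : Fin n → EuclideanSpace ℝ (Fin d) → EReal)
    (hf_proper : ∀ i, ProperFn (f i)) (hf_closed : ∀ i, LowerSemicontinuous (f i))
    (hf_strong : ∀ i, StronglyConvexFn (σ i) (f i))
    (hg_proper : ∀ i, ProperFn (g i)) (hg_closed : ∀ i, LowerSemicontinuous (g i))
    (hg_convex : ∀ i, ConvexFn (g i))
    -- constraint qualification: the relative interiors of the domains of `Σ_i f_i` and
    -- `Σ_i g_i` intersect
    (hCQ : (intrinsicInterior ℝ {x : EuclideanSpace ℝ (Fin d) | (∑ i, f i x) ≠ ⊤} ∩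
        intrinsicInterior ℝ {x : EuclideanSpace ℝ (Fin d) | (∑ i, g i x) ≠ ⊤}).Nonempty)
    -- local step-sizes
    (α : Fin n → ℝ) (hαpos : ∀ i, 0 < α i)
    (hαle : ∀ i, α i ≤ 1 / (n * Real.sqrt ((1 / σ i) ^ 2 +
      ∑ j ∈ G.neighborFinset i, (1 / σ i + 1 / σ j) ^ 2)))
    -- the iterates: dual variables `λ_i^j(t)`, `μ_i(t)` and primal variables `x_i⋆(t)`
    (lam : ℕ → Fin n → Fin n → EuclideanSpace ℝ (Fin d))
    (mu : ℕ → Fin n → EuclideanSpace ℝ (Fin d))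
    (xstar : ℕ → Fin n → EuclideanSpace ℝ (Fin d))
    -- `x_i⋆(t)` minimizes `x ↦ ⟨x, Σ_{j∈N_i}(λ_i^j(t) − λ_j^i(t)) + μ_i(t)⟩ + f_i(x)`
    (h_x : ∀ (t : ℕ) (i : Fin n) (x : EuclideanSpace ℝ (Fin d)),
      (⟪xstar t i, (∑ j ∈ G.neighborFinset i, (lam t i j - lam t j i)) + mu t i⟫ : EReal)
          + f i (xstar t i) ≤
        (⟪x, (∑ j ∈ G.neighborFinset i, (lam t i j - lam t j i)) + mu t i⟫ : EReal)
          + f i x)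
    -- `λ_i^j(t+1) = λ_i^j(t) + α_i (x_i⋆(t) − x_j⋆(t))` for `j ∈ N_i`
    (h_lam : ∀ (t : ℕ) (i j : Fin n), G.Adj i j →
      lam (t + 1) i j = lam t i j + α i • (xstar t i - xstar t j))
    (h_lam_other : ∀ (t : ℕ) (i j : Fin n), ¬ G.Adj i j → lam (t + 1) i j = lam t i j)
    -- `μ_i(t+1) = μ̃_i − α_i prox_{(1/α_i) g_i}(μ̃_i/α_i)` with `μ̃_i = μ_i(t) + α_i x_i⋆(t)`
    (h_mu : ∀ (t : ℕ) (i : Fin n), ∃ p : EuclideanSpace ℝ (Fin d),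
      (∀ x : EuclideanSpace ℝ (Fin d),
        g i p + (((α i / 2) *
            ‖p - (α i)⁻¹ • (mu t i + α i • xstar t i)‖ ^ 2 : ℝ) : EReal) ≤
          g i x + (((α i / 2) *
            ‖x - (α i)⁻¹ • (mu t i + α i • xstar t i)‖ ^ 2 : ℝ) : EReal)) ∧
      mu (t + 1) i = (mu t i + α i • xstar t i) - α i • p) :
    -- conclusion: `O(1/t)` rate in dual objective value
    ∀ (lamstar : Fin n → Fin n → EuclideanSpace ℝ (Fin d))
      (mustar : Fin n → EuclideanSpace ℝ (Fin d)),
      (∀ lam' mu', dualCost G f g lamstar mustar ≤ dualCost G f g lam' mu') →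
      ∀ t : ℕ, 1 ≤ t →
        dualCost G f g (lam t) (mu t) - dualCost G f g lamstar mustar ≤
          (((∑ i, (1 / α i) *
              ((∑ j ∈ G.neighborFinset i, ‖lam 0 i j - lamstar i j‖ ^ 2) +
                ‖mu 0 i - mustar i‖ ^ 2)) / (2 * t) : ℝ) : EReal) := by
  intro lamstar mustar hstar t ht
  have hfmin (t i) := (hf_proper i).exists_coe_of_minimizer
    (q := fun x => ⟪x, dualArg G (lam t) (mu t) i⟫) (h_x t i)
  choose r hr hrmin using hfmin
  have hfgrow (t i) {x : EuclideanSpace ℝ (Fin d)} {s : ℝ} (hx : f i x ≤ s) :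
      r t i + ⟪xstar t i, dualArg G (lam t) (mu t) i⟫ + σ i / 2 * ‖x - xstar t i‖ ^ 2
        ≤ s + ⟪x, dualArg G (lam t) (mu t) i⟫ := by
    have := (hf_strong i).epi.growth (τ := 0)
      (q := fun x => ⟪x, dualArg G (lam t) (mu t) i⟫)
      (fun x y a b _ => by simp [inner_add_left, real_inner_smul_left])
      (hr t i).le (hrmin t i) hx
    simpa using this
  have hfconj (t i) : conjugateFn (f i) (-dualArg G (lam t) (mu t) i)
      = ((-⟪xstar t i, dualArg G (lam t) (mu t) i⟫ - r t i : ℝ) : EReal) := by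
    rw [conjugateFn_eq (hf_proper i) (hr t i), inner_neg_left, real_inner_comm]
    intro x s hx
    have := hrmin t i x s hx
    rw [inner_neg_left, inner_neg_left, real_inner_comm, real_inner_comm (xstar t i)]
    linarith
  choose p hpmin hmu using h_mu
  have hgmin (t i) := (hg_proper i).exists_coe_of_minimizer
    (q := fun x => α i / 2 * ‖x - (α i)⁻¹ • (mu t i + α i • xstar t i)‖ ^ 2) (p := p t i)
    (fun x => by simpa only [add_comm] using hpmin t i x)
  choose ρ hρ hρmin using hgmin
  have hggrow (t i) {x : EuclideanSpace ℝ (Fin d)} {s : ℝ} (hx : g i x ≤ s) :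
      ⟪mu (t + 1) i, x⟫ - s ≤ ⟪mu (t + 1) i, p t i⟫ - ρ t i := by
    set c := (α i)⁻¹ • (mu t i + α i • xstar t i) with hc
    have h1 := (hg_convex i).epi.growth (τ := α i) (q := fun x => α i / 2 * ‖x - c‖ ^ 2)
      (fun x y a b hab => by
        have h2 : a • x + b • y - c = a • (x - c) + b • (y - c) := by
          obtain rfl : b = 1 - a := by linarith
          module
        rw [h2, norm_sq_convex_combination _ _ hab, sub_sub_sub_cancel_right]
        ring)
      (hρ t i).le (hρmin t i) hx
    have h2 : mu (t + 1) i = α i • (c - p t i) := by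
      rw [hmu, smul_sub, hc, smul_smul, mul_inv_cancel₀ (hαpos i).ne', one_smul]
    have h3 : ‖x - c‖ ^ 2 = ‖x - p t i‖ ^ 2 - 2 * ⟪x - p t i, c - p t i⟫ + ‖p t i - c‖ ^ 2 := by
      rw [← sub_sub_sub_cancel_right x c (p t i), norm_sub_sq_real, norm_sub_rev c]
    rw [h3] at h1
    rw [h2, real_inner_smul_left, real_inner_smul_left, real_inner_comm, real_inner_comm (p t i)]
    rw [inner_sub_left] at h1
    linarith
  have hgconj (t i) : conjugateFn (g i) (mu (t + 1) i)
      = ((⟪mu (t + 1) i, p t i⟫ - ρ t i : ℝ) : EReal) :=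
    conjugateFn_eq (hg_proper i) (hρ t i) fun x s hx => hggrow t i hx
  have hcost (t) : dualCost G f g (lam (t + 1)) (mu (t + 1))
      = ((∑ i, (-⟪xstar (t + 1) i, dualArg G (lam (t + 1)) (mu (t + 1)) i⟫ - r (t + 1) i)
        + ∑ i, (⟪mu (t + 1) i, p t i⟫ - ρ t i) : ℝ) : EReal) := by
    rw [dualCost_eq]
    simp only [hfconj, hgconj, EReal.coe_add, EReal.coe_sum]
  have hFbot : ∀ i ∈ Finset.univ, conjugateFn (f i) (-dualArg G lamstar mustar i) ≠ ⊥ :=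
    fun i _ => conjugateFn_ne_bot (hf_proper i) _
  have hGbot : ∀ i ∈ Finset.univ, conjugateFn (g i) (mustar i) ≠ ⊥ :=
    fun i _ => conjugateFn_ne_bot (hg_proper i) _
  have htop : dualCost G f g lamstar mustar ≠ ⊤ :=
    ne_top_of_le_ne_top (EReal.coe_ne_top _) ((hstar _ _).trans_eq (hcost 0))
  rw [dualCost_eq] at htop
  have hFtop : ∑ i, conjugateFn (f i) (-dualArg G lamstar mustar i) ≠ ⊤ := fun h =>
    htop (by rw [h, EReal.top_add_of_ne_bot (EReal.sum_ne_bot hGbot)])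
  have hGtop : ∑ i, conjugateFn (g i) (mustar i) ≠ ⊤ := fun h =>
    htop (by rw [h, EReal.add_top_of_ne_bot (EReal.sum_ne_bot hFbot)])
  have hFu (i) : ∃ c : ℝ, conjugateFn (f i) (-dualArg G lamstar mustar i) = c :=
    ⟨_, (EReal.coe_toReal (EReal.ne_top_of_sum_ne_top hFbot hFtop (Finset.mem_univ i))
      (hFbot i (Finset.mem_univ i))).symm⟩
  have hGu (i) : ∃ c : ℝ, conjugateFn (g i) (mustar i) = c :=
    ⟨_, (EReal.coe_toReal (EReal.ne_top_of_sum_ne_top hGbot hGtop (Finset.mem_univ i))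
      (hGbot i (Finset.mem_univ i))).symm⟩
  choose Fu hFu using hFu
  choose Gu hGu using hGu
  have hcoststar : dualCost G f g lamstar mustar = ((∑ i, Fu i + ∑ i, Gu i : ℝ) : EReal) := by
    rw [dualCost_eq]
    simp only [hFu, hGu, EReal.coe_add, EReal.coe_sum]
  have hlin (s : ℕ) (l : Fin n → Fin n → EuclideanSpace ℝ (Fin d))
      (m : Fin n → EuclideanSpace ℝ (Fin d)) :
      ∑ i, (-⟪xstar s i, dualArg G (lam s) (mu s) i⟫ - r s i)
        + ⟪scaledGrad G α (xstar s), scaledDual G α l m - scaledDual G α (lam s) (mu s)⟫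
        = ∑ i, (-⟪xstar s i, dualArg G l m i⟫ - r s i) := by
    rw [scaledDual_sub, inner_scaledGrad G hαpos, ← sub_eq_add_neg, ← Finset.sum_sub_distrib]
    refine Finset.sum_congr rfl fun i _ => ?_
    rw [dualArg_sub, inner_sub_right]
    ring
  have hcoc (s t : ℕ) : 2 / 5 * ‖scaledGrad G α (xstar s) - scaledGrad G α (xstar t)‖ ^ 2
      ≤ ∑ i, σ i / 2 * ‖xstar s i - xstar t i‖ ^ 2 := by
    rw [scaledGrad_sub]
    have := norm_sq_scaledGrad_le G hσ hαpos hαle fun i => xstar s i - xstar t i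
    simp only [div_mul_eq_mul_div, ← Finset.sum_div]
    linarith
  have hFineq (s t : ℕ) (a : ℝ) (ha : 0 ≤ a) (ha1 : a ≤ 1) :
      a * ∑ i, (-⟪xstar s i, dualArg G lamstar mustar i⟫ - r s i)
        + (1 - a) * ∑ i, (-⟪xstar t i, dualArg G lamstar mustar i⟫ - r t i)
        + a * (1 - a) * ∑ i, σ i / 2 * ‖xstar s i - xstar t i‖ ^ 2 ≤ ∑ i, Fu i := by
    simp only [Finset.mul_sum, ← Finset.sum_add_distrib]
    refine Finset.sum_le_sum fun i _ => ?_
    have h1 := le_conjugateFn (-dualArg G lamstar mustar i) ((hf_strong i).epi _ _ _ _ a (1 - a) ha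
      (by linarith) (by ring) (hr s i).le (hr t i).le)
    rw [hFu, EReal.coe_le_coe_iff] at h1
    simp only [inner_neg_left, inner_add_right, real_inner_smul_right] at h1
    rw [real_inner_comm, real_inner_comm (dualArg G lamstar mustar i)]
    linarith
  have hGineq (t : ℕ) (m : Fin n → EuclideanSpace ℝ (Fin d)) (γ : Fin n → ℝ)
      (hγ : ∀ i, conjugateFn (g i) (m i) = γ i)
      (l : Fin n → Fin n → EuclideanSpace ℝ (Fin d)) :
      ∑ i, (⟪mu (t + 1) i, p t i⟫ - ρ t i)
        + ⟪scaledDual G α (lam t) (mu t) - scaledDual G α (lam (t + 1)) (mu (t + 1))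
            - scaledGrad G α (xstar t),
          scaledDual G α l m - scaledDual G α (lam (t + 1)) (mu (t + 1))⟫ ≤ ∑ i, γ i := by
    rw [scaledDual_sub G l, scaledDual_step G hαpos (h_lam t) (hmu t), ← Finset.sum_add_distrib]
    refine Finset.sum_le_sum fun i _ => ?_
    have h1 := le_conjugateFn (m i) (hρ t i).le
    rw [hγ, EReal.coe_le_coe_iff] at h1
    rw [inner_sub_right, real_inner_comm (mu (t + 1) i), real_inner_comm (m i)]
    linarith
  obtain ⟨t, rfl⟩ : ∃ k, t = k + 1 := ⟨t - 1, by omega⟩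
  have main := proxGrad_rate (fun t => scaledDual G α (lam t) (mu t))
    (fun t => scaledGrad G α (xstar t))
    (fun t => ∑ i, (-⟪xstar t i, dualArg G (lam t) (mu t) i⟫ - r t i))
    (fun t => ∑ i, (⟪mu t i, p (t - 1) i⟫ - ρ (t - 1) i))
    (scaledDual G α lamstar mustar) (∑ i, Fu i) (∑ i, Gu i)
    (fun s t a ha ha1 => by
      rw [hlin, hlin]
      have := mul_le_mul_of_nonneg_left (hcoc s t) (mul_nonneg ha (sub_nonneg.2 ha1))
      linarith [hFineq s t a ha ha1])
    (fun s t => by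
      rw [hlin]
      refine (add_le_add_right (hcoc s t) _).trans ?_
      rw [← Finset.sum_add_distrib]
      refine Finset.sum_le_sum fun i _ => ?_
      linarith [hfgrow t i (hr s i).le])
    (fun t => hGineq t mustar Gu hGu lamstar)
    (fun t s => hGineq t (mu (s + 1)) _ (hgconj s) (lam (s + 1))) t
  rw [hcost, hcoststar, ← EReal.coe_sub, EReal.coe_le_coe_iff, le_div_iff₀ (by positivity)]
  rw [scaledDual_sub, norm_sq_scaledDual G hαpos] at main
  simp only [Nat.add_sub_cancel] at main
  push_cast
  linarith

end
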